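/- arXiv:2604.20294 — 2 statements merged into one kernel-verified Lean document; each statement's English description precedes it below -/
import Mathlib

section
/- Let X and Y be Archimedean vector lattices, let T : X → Y be a vector lattice homomorphism (a linear map preserving binary suprema), and let e ∈ X with e ≥ 0. Then T(I_e) ⊆ I_{T(e)}, and for every x ∈ I_e one has ‖T(x)‖_{T(e)} ≤ ‖x‖_e (i.e., the restriction T : (I_e, ‖·‖_e) → (I_{T(e)}, ‖·‖_{T(e)}) is contractive). Moreover, if (I_e, ‖·‖_e) is norm complete, then the restriction of ‖·‖_{T(e)} to T(X) ∩ I_{T(e)} is complete, i.e., every ‖·‖_{T(e)}-Cauchy sequence in T(X) ∩ I_{T(e)} converges in ‖·‖_{T(e)} to an element of T(X) ∩ I_{T(e)}. -/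
open scoped BigOperators

/-- A continuous function `ℝⁿ → ℝ` of polynomial growth (an element of `PG_n`). -/
def PolyGrowth (n : ℕ) (f : (Fin n → ℝ) → ℝ) : Prop :=
  Continuous f ∧ ∃ (M : ℝ) (N : ℕ), 0 ≤ M ∧
    ∀ t : Fin n → ℝ, |f t| ≤ M * (1 + ∑ i : Fin n, |t i|) ^ N

/-- An element of `PG_n^h`: a polynomial growth continuous function `f` such that
`f (t • x) / t` converges as `t → 0⁺`, uniformly in `x` on every bounded set. -/
def PolyGrowthH (n : ℕ) (f : (Fin n → ℝ) → ℝ) : Prop :=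
  PolyGrowth n f ∧ ∃ fh : (Fin n → ℝ) → ℝ,
    ∀ B : Set (Fin n → ℝ), Bornology.IsBounded B →
      ∀ ε : ℝ, 0 < ε → ∃ δ : ℝ, 0 < δ ∧
        ∀ t : ℝ, 0 < t → t < δ → ∀ y ∈ B, |f (t • y) / t - fh y| < ε

/-- An element of `H_n`: a continuous positively homogeneous function `ℝⁿ → ℝ`. -/
def PosHomog (n : ℕ) (f : (Fin n → ℝ) → ℝ) : Prop :=
  Continuous f ∧ ∀ (c : ℝ), 0 ≤ c → ∀ t : Fin n → ℝ, f (c • t) = c * f t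

section Defs

variable {X : Type*} [Lattice X] [AddCommGroup X] [Module ℝ X]

/-- The order ideal `I_e` generated by `e`. -/
def idealSet (e : X) : Set X := {x : X | ∃ c : ℝ, 0 ≤ c ∧ |x| ≤ c • e}

/-- The norm `‖x‖_e = inf {c ≥ 0 : |x| ≤ c • e}`. -/
noncomputable def regNorm (e x : X) : ℝ := sInf {c : ℝ | 0 ≤ c ∧ |x| ≤ c • e}

/-- The norm `‖·‖_e` is complete on the set `S`: every `‖·‖_e`-Cauchy sequence in `S`
converges, in `‖·‖_e`, to an element of `S`. -/
def NormComplete (e : X) (S : Set X) : Prop :=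
  ∀ u : ℕ → X, (∀ k, u k ∈ S) →
    (∀ ε : ℝ, 0 < ε → ∃ N : ℕ, ∀ p q : ℕ, N ≤ p → N ≤ q → regNorm e (u p - u q) < ε) →
    ∃ x ∈ S, ∀ ε : ℝ, 0 < ε → ∃ N : ℕ, ∀ p : ℕ, N ≤ p → regNorm e (u p - x) < ε

/-- A uniformly complete vector lattice: `(I_e, ‖·‖_e)` is complete for every `e ≥ 0`. -/
def UniformlyComplete (X : Type*) [Lattice X] [AddCommGroup X] [Module ℝ X] : Prop :=
  ∀ e : X, 0 ≤ e → NormComplete e (idealSet e)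

/-- A subset `Z` is uniformly complete as a vector lattice in its own right. -/
def UCSet (Z : Set X) : Prop :=
  ∀ e ∈ Z, 0 ≤ e → NormComplete e (Z ∩ idealSet e)

/-- A (vector) sublattice: a linear subspace closed under binary suprema. -/
def IsSublatticeSet (Z : Set X) : Prop :=
  (0 ∈ Z) ∧ (∀ a ∈ Z, ∀ b ∈ Z, a + b ∈ Z) ∧ (∀ (c : ℝ), ∀ a ∈ Z, c • a ∈ Z) ∧
  (∀ a ∈ Z, -a ∈ Z) ∧ (∀ a ∈ Z, ∀ b ∈ Z, a ⊔ b ∈ Z) ∧ (∀ a ∈ Z, ∀ b ∈ Z, a ⊓ b ∈ Z)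

/-- An order ideal: a linear subspace that is solid. -/
def IsOrderIdealSet (I : Set X) : Prop :=
  (0 ∈ I) ∧ (∀ a ∈ I, ∀ b ∈ I, a + b ∈ I) ∧ (∀ (c : ℝ), ∀ a ∈ I, c • a ∈ I) ∧
  (∀ a ∈ I, ∀ b : X, |b| ≤ |a| → b ∈ I)

/-- A vector lattice homomorphism defined on the class of functions `ℝⁿ → ℝ`
satisfying the predicate `P` (with pointwise operations), taking values in `X`. -/
def IsLatHom {n : ℕ} (P : ((Fin n → ℝ) → ℝ) → Prop) (Φ : ∀ f, P f → X) : Prop :=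
  (∀ (f g : (Fin n → ℝ) → ℝ) (hf : P f) (hg : P g) (hfg : P (f + g)),
      Φ (f + g) hfg = Φ f hf + Φ g hg) ∧
  (∀ (c : ℝ) (f : (Fin n → ℝ) → ℝ) (hf : P f) (hcf : P (c • f)),
      Φ (c • f) hcf = c • Φ f hf) ∧
  (∀ (f g : (Fin n → ℝ) → ℝ) (hf : P f) (hg : P g) (hfg : P (f ⊔ g)),
      Φ (f ⊔ g) hfg = Φ f hf ⊔ Φ g hg)

end Defs

section MulDefs

variable {X : Type*} [Lattice X] [AddCommGroup X] [Module ℝ X] [Mul X]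

/-- A lattice-algebra homomorphism defined on the class of functions `ℝⁿ → ℝ`
satisfying the predicate `P` (with pointwise operations), taking values in `X`. -/
def IsLatAlgHom {n : ℕ} (P : ((Fin n → ℝ) → ℝ) → Prop) (Ψ : ∀ f, P f → X) : Prop :=
  IsLatHom P Ψ ∧
  (∀ (f g : (Fin n → ℝ) → ℝ) (hf : P f) (hg : P g) (hfg : P (f * g)),
      Ψ (f * g) hfg = Ψ f hf * Ψ g hg)

/-- A sublattice-algebra: a linear subspace that is both a sublattice and a subalgebra. -/
def IsSublatticeAlgebraSet (Z : Set X) : Prop :=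
  IsSublatticeSet Z ∧ ∀ a ∈ Z, ∀ b ∈ Z, a * b ∈ Z

/-- The `f`-algebra condition, relativized to a subset. -/
def IsFAlgebraSet (Z : Set X) : Prop :=
  ∀ a ∈ Z, ∀ b ∈ Z, ∀ z ∈ Z, a ⊓ b = 0 → 0 ≤ z → (z * a) ⊓ b = 0 ∧ (a * z) ⊓ b = 0

/-- An `f`-subalgebra: a sublattice-algebra which is itself an `f`-algebra. -/
def IsFSubalgebra (Z : Set X) : Prop := IsSublatticeAlgebraSet Z ∧ IsFAlgebraSet Z

/-- `powS e m = e^(m+1)`, defined without assuming an identity element. -/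
def powS (e : X) : ℕ → X
  | 0 => e
  | m + 1 => powS e m * e

end MulDefs

/-- A map `T : X → A` which is a lattice-algebra homomorphism on a subset `S` of `X`. -/
def IsLatAlgHomOn {X A : Type*} [Lattice X] [AddCommGroup X] [Module ℝ X] [Mul X]
    [Lattice A] [AddCommGroup A] [Module ℝ A] [Mul A] (S : Set X) (T : X → A) : Prop :=
  (∀ a ∈ S, ∀ b ∈ S, T (a + b) = T a + T b) ∧
  (∀ (c : ℝ), ∀ a ∈ S, T (c • a) = c • T a) ∧
  (∀ a ∈ S, ∀ b ∈ S, T (a ⊔ b) = T a ⊔ T b) ∧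
  (∀ a ∈ S, ∀ b ∈ S, T (a * b) = T a * T b)

theorem isOrderedModule_of_smul_nonneg {X : Type*} [Lattice X] [AddCommGroup X] [Module ℝ X]
    [IsOrderedAddMonoid X] (h : ∀ (c : ℝ) (a : X), 0 ≤ c → 0 ≤ a → 0 ≤ c • a) :
    IsOrderedModule ℝ X where
  smul_le_smul_of_nonneg_left c hc a b hab := by
    have := h c (b - a) hc (sub_nonneg.2 hab)
    rwa [smul_sub, sub_nonneg] at this
  smul_le_smul_of_nonneg_right a ha c d hcd := by
    have := h (d - c) a (sub_nonneg.2 hcd) ha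
    rwa [sub_smul, sub_nonneg] at this

section RegNorm

variable {X : Type*} [Lattice X] [AddCommGroup X] [Module ℝ X]

theorem regNorm_le_of_abs_le_smul {e x : X} {c : ℝ} (hc : 0 ≤ c) (h : |x| ≤ c • e) :
    regNorm e x ≤ c :=
  csInf_le ⟨0, fun _ hd => hd.1⟩ ⟨hc, h⟩

variable [IsOrderedAddMonoid X]

theorem abs_add_le_smul {e x y : X} {c d : ℝ} (hx : |x| ≤ c • e) (hy : |y| ≤ d • e) :
    |x + y| ≤ (c + d) • e := by
  rw [add_smul]
  refine abs_le'.2 ⟨add_le_add ((le_abs_self x).trans hx) ((le_abs_self y).trans hy), ?_⟩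
  rw [neg_add]
  exact add_le_add ((neg_le_abs x).trans hx) ((neg_le_abs y).trans hy)

theorem abs_sub_le_smul {e x y : X} {c d : ℝ} (hx : |x| ≤ c • e) (hy : |y| ≤ d • e) :
    |x - y| ≤ (c + d) • e := by
  rw [sub_eq_add_neg]
  exact abs_add_le_smul hx ((abs_neg y).trans_le hy)

theorem add_mem_idealSet {e x y : X} (hx : x ∈ idealSet e) (hy : y ∈ idealSet e) :
    x + y ∈ idealSet e := by
  obtain ⟨c, hc, hx⟩ := hx
  obtain ⟨d, hd, hy⟩ := hy
  exact ⟨c + d, add_nonneg hc hd, abs_add_le_smul hx hy⟩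

theorem sub_mem_idealSet {e x y : X} (hx : x ∈ idealSet e) (hy : y ∈ idealSet e) :
    x - y ∈ idealSet e := by
  obtain ⟨c, hc, hx⟩ := hx
  obtain ⟨d, hd, hy⟩ := hy
  exact ⟨c + d, add_nonneg hc hd, abs_sub_le_smul hx hy⟩

variable [IsOrderedModule ℝ X]

theorem abs_le_smul_of_regNorm_lt {e x : X} {c : ℝ} (he : 0 ≤ e) (hx : x ∈ idealSet e)
    (h : regNorm e x < c) : |x| ≤ c • e := by
  obtain ⟨d, ⟨_, hd⟩, hdc⟩ := exists_lt_of_csInf_lt (s := {c : ℝ | 0 ≤ c ∧ |x| ≤ c • e}) hx h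
  exact hd.trans (smul_le_smul_of_nonneg_right hdc.le he)

/-- Partial sums of a series dominated by `(1 / 2) ^ n • e` are uniformly close. -/
theorem abs_sub_le_smul_of_geometric {e : X} (he : 0 ≤ e) {x : ℕ → X}
    (hx : ∀ n, |x (n + 1) - x n| ≤ ((1 / 2 : ℝ) ^ n) • e) {n m : ℕ} (hnm : n ≤ m) :
    |x m - x n| ≤ (2 * (1 / 2 : ℝ) ^ n) • e := by
  have key : |x m - x n| ≤ (2 * (1 / 2 : ℝ) ^ n - 2 * (1 / 2 : ℝ) ^ m) • e := by
    induction m, hnm using Nat.le_induction with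
    | base => simp
    | succ m _ ih =>
      have h := abs_add_le_smul (hx m) ih
      rw [sub_add_sub_cancel] at h
      convert h using 2
      ring
  refine key.trans (smul_le_smul_of_nonneg_right ?_ he)
  have : (0 : ℝ) ≤ (1 / 2) ^ m := by positivity
  linarith

/-- In a norm complete ideal, a sequence with geometrically decaying increments converges. -/
theorem NormComplete.exists_limit_of_geometric {e : X} (he : 0 ≤ e)
    (hcomp : NormComplete e (idealSet e)) {x : ℕ → X} (hmem : ∀ n, x n ∈ idealSet e)
    (hx : ∀ n, |x (n + 1) - x n| ≤ ((1 / 2 : ℝ) ^ n) • e) :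
    ∃ l ∈ idealSet e, ∀ ε : ℝ, 0 < ε → ∃ N : ℕ, ∀ p, N ≤ p → |x p - l| ≤ ε • e := by
  obtain ⟨l, hl, hlim⟩ := hcomp x hmem fun ε hε => by
    obtain ⟨N, hN⟩ := exists_pow_lt_of_lt_one (show 0 < ε / 4 by positivity)
      (show (1 / 2 : ℝ) < 1 by norm_num)
    refine ⟨N, fun p q hp hq => ?_⟩
    have h := abs_sub_le_smul (abs_sub_le_smul_of_geometric he hx hp)
      (abs_sub_le_smul_of_geometric he hx hq)
    rw [sub_sub_sub_cancel_right] at h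
    exact (regNorm_le_of_abs_le_smul (by positivity) h).trans_lt (by linarith)
  refine ⟨l, hl, fun ε hε => ?_⟩
  obtain ⟨N, hN⟩ := hlim ε hε
  exact ⟨N, fun p hp => abs_le_smul_of_regNorm_lt he (sub_mem_idealSet (hmem p) hl) (hN p hp)⟩

end RegNorm

section Hom

variable {X Y : Type*} [Lattice X] [AddCommGroup X] [Module ℝ X]
  [Lattice Y] [AddCommGroup Y] [Module ℝ Y] {T : X →ₗ[ℝ] Y}

theorem LinearMap.map_abs_of_map_sup (hsup : ∀ a b, T (a ⊔ b) = T a ⊔ T b) (a : X) :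
    T |a| = |T a| := by
  rw [abs, abs, hsup, map_neg]

theorem LinearMap.abs_map_le_smul (hsup : ∀ a b, T (a ⊔ b) = T a ⊔ T b) {e a : X} {c : ℝ}
    (h : |a| ≤ c • e) : |T a| ≤ c • T e := by
  rw [← map_abs_of_map_sup hsup, ← map_smul, ← sup_eq_right, ← hsup, sup_eq_right.2 h]

variable [IsOrderedAddMonoid X] [IsOrderedAddMonoid Y]

/-- An element of the range dominated by `c • T e` lifts to an element dominated by `c • e`. -/
theorem LinearMap.exists_lift_abs_le_smul [IsOrderedModule ℝ X]
    (hsup : ∀ a b, T (a ⊔ b) = T a ⊔ T b) {e : X} (he : 0 ≤ e) {c : ℝ} (hc : 0 ≤ c) {y : Y}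
    (hy : y ∈ Set.range T) (h : |y| ≤ c • T e) : ∃ x, T x = y ∧ |x| ≤ c • e := by
  obtain ⟨w, rfl⟩ := hy
  have hce : 0 ≤ c • e := smul_nonneg hc he
  have hle : T w ≤ c • T e := (le_abs_self _).trans h
  have hge : -(c • T e) ≤ T w := neg_le.1 ((neg_le_abs _).trans h)
  refine ⟨-(-(w ⊔ -(c • e)) ⊔ -(c • e)), ?_, ?_⟩
  · rw [map_neg, hsup, map_neg, hsup, map_neg, map_smul, sup_eq_left.2 hge,
      sup_eq_left.2 (neg_le_neg hle), neg_neg]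
  · rw [abs_neg]
    refine abs_le'.2 ⟨sup_le (neg_le.1 le_sup_right) ((neg_nonpos.2 hce).trans hce), ?_⟩
    exact neg_le.1 le_sup_right

/-- The image under a lattice homomorphism of a norm complete principal ideal is complete. -/
theorem NormComplete.range_inter_idealSet [IsOrderedModule ℝ X] [IsOrderedModule ℝ Y]
    (hsup : ∀ a b, T (a ⊔ b) = T a ⊔ T b) {e : X} (he : 0 ≤ e) (hTe : 0 ≤ T e)
    (hcomp : NormComplete e (idealSet e)) :
    NormComplete (T e) (Set.range T ∩ idealSet (T e)) := by
  intro y hy hcauchy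
  have hcauchy' : ∀ n : ℕ, ∃ N : ℕ, ∀ p q, N ≤ p → N ≤ q →
      |y p - y q| ≤ ((1 / 2 : ℝ) ^ n) • T e := fun n => by
    obtain ⟨N, hN⟩ := hcauchy ((1 / 2) ^ n) (by positivity)
    exact ⟨N, fun p q hp hq =>
      abs_le_smul_of_regNorm_lt hTe (sub_mem_idealSet (hy p).2 (hy q).2) (hN p q hp hq)⟩
  choose N hN using hcauchy'
  let φ : ℕ → ℕ := fun n => ∑ i ∈ Finset.range (n + 1), N i
  have hφ : ∀ {i n}, i ≤ n → N i ≤ φ n := fun {i n} hin =>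
    Finset.single_le_sum (f := N) (fun _ _ => Nat.zero_le _)
      (Finset.mem_range.2 (Nat.lt_succ_of_le hin))
  have hlift : ∀ n, ∃ d, T d = y (φ (n + 1)) - y (φ n) ∧ |d| ≤ ((1 / 2 : ℝ) ^ n) • e := fun n => by
    refine LinearMap.exists_lift_abs_le_smul hsup he (by positivity) ?_
      (hN n _ _ (hφ n.le_succ) (hφ le_rfl))
    obtain ⟨a, ha⟩ := (hy (φ (n + 1))).1
    obtain ⟨b, hb⟩ := (hy (φ n)).1
    exact ⟨a - b, by rw [map_sub, ha, hb]⟩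
  choose d hTd hd using hlift
  obtain ⟨c, hc, hyc⟩ := (hy (φ 0)).2
  obtain ⟨x₀, hTx₀, hx₀⟩ := LinearMap.exists_lift_abs_le_smul hsup he hc (hy (φ 0)).1 hyc
  let x : ℕ → X := fun n => x₀ + ∑ i ∈ Finset.range n, d i
  have hsucc : ∀ n, x (n + 1) = x n + d n := fun n => by
    simp only [x, Finset.sum_range_succ, add_assoc]
  have hmem : ∀ n, x n ∈ idealSet e := fun n => by
    induction n with
    | zero => exact ⟨c, hc, by simpa [x] using hx₀⟩
    | succ n ih => exact hsucc n ▸ add_mem_idealSet ih ⟨_, by positivity, hd n⟩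
  have hTx : ∀ n, T (x n) = y (φ n) := fun n => by
    induction n with
    | zero => simpa [x] using hTx₀
    | succ n ih => rw [hsucc, map_add, ih, hTd, add_sub_cancel]
  obtain ⟨l, ⟨b, hb, hlb⟩, hlim⟩ := hcomp.exists_limit_of_geometric he hmem
    fun n => by rw [hsucc, add_sub_cancel_left]; exact hd n
  refine ⟨T l, ⟨⟨l, rfl⟩, b, hb, LinearMap.abs_map_le_smul hsup hlb⟩, fun ε hε => ?_⟩
  obtain ⟨n, hn⟩ := exists_pow_lt_of_lt_one (show 0 < ε / 2 by positivity)
    (show (1 / 2 : ℝ) < 1 by norm_num)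
  obtain ⟨K, hK⟩ := hlim (ε / 2) (by positivity)
  refine ⟨N n, fun p hp => ?_⟩
  have h₁ := hN n p (φ (max n K)) hp (hφ (le_max_left n K))
  have h₂ := LinearMap.abs_map_le_smul hsup (hK _ (le_max_right n K))
  rw [map_sub, hTx] at h₂
  have h := abs_add_le_smul h₁ h₂
  rw [sub_add_sub_cancel] at h
  exact (regNorm_le_of_abs_le_smul (by positivity) h).trans_lt (by linarith)

end Hom

/-- Lemma 3.3 / `lem:prelim1`. -/
theorem stmt_8 {X Y : Type*} [Lattice X] [AddCommGroup X] [Module ℝ X]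
    [Lattice Y] [AddCommGroup Y] [Module ℝ Y]
    [CovariantClass X X (· + ·) (· ≤ ·)] [CovariantClass Y Y (· + ·) (· ≤ ·)]
    (hsmulposX : ∀ (c : ℝ) (a : X), 0 ≤ c → 0 ≤ a → 0 ≤ c • a)
    (harchX : ∀ a b : X, 0 ≤ a → 0 ≤ b → (∀ k : ℕ, k • a ≤ b) → a = 0)
    (hsmulposY : ∀ (c : ℝ) (a : Y), 0 ≤ c → 0 ≤ a → 0 ≤ c • a)
    (harchY : ∀ a b : Y, 0 ≤ a → 0 ≤ b → (∀ k : ℕ, k • a ≤ b) → a = 0)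
    (T : X → Y)
    (hadd : ∀ a b : X, T (a + b) = T a + T b)
    (hsmul : ∀ (c : ℝ) (a : X), T (c • a) = c • T a)
    (hsup : ∀ a b : X, T (a ⊔ b) = T a ⊔ T b)
    (e : X) (he : 0 ≤ e) :
    (∀ a ∈ idealSet e, T a ∈ idealSet (T e)) ∧
    (∀ a ∈ idealSet e, regNorm (T e) (T a) ≤ regNorm e a) ∧
    (NormComplete e (idealSet e) →
      NormComplete (T e) (Set.range T ∩ idealSet (T e))) := by
  have : IsOrderedAddMonoid X :=
    { add_le_add_left := fun _ _ h c => add_le_add_left h c }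
  have : IsOrderedAddMonoid Y :=
    { add_le_add_left := fun _ _ h c => add_le_add_left h c }
  have := isOrderedModule_of_smul_nonneg hsmulposX
  have := isOrderedModule_of_smul_nonneg hsmulposY
  let L : X →ₗ[ℝ] Y := { toFun := T, map_add' := hadd, map_smul' := hsmul }
  have hL : ∀ a b, L (a ⊔ b) = L a ⊔ L b := hsup
  have hLe : 0 ≤ L e := by
    have h := hL 0 e
    rwa [sup_eq_right.2 he, map_zero, eq_comm, sup_eq_right] at h
  refine ⟨?_, ?_, NormComplete.range_inter_idealSet (T := L) hL he hLe⟩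
  · rintro a ⟨c, hc, ha⟩
    exact ⟨c, hc, LinearMap.abs_map_le_smul (T := L) hL ha⟩
  · intro a ha
    exact le_csInf ha fun c hc =>
      regNorm_le_of_abs_le_smul hc.1 (LinearMap.abs_map_le_smul (T := L) hL hc.2)
end

section
/- Let X be an Archimedean lattice-ordered algebra and let e ∈ X with e ≥ 0 be such that e^m ∈ I_{e^{m+1}} for every m ∈ ℕ. Then IA_e, the smallest linear subspace of X containing e that is simultaneously an order ideal and a subalgebra, equals ⋃_{m∈ℕ} I_{e^m}; moreover I_{e^m} ⊆ I_{e^{m+1}} for every m ∈ ℕ. -/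
open scoped BigOperators

/-- A nonnegative element belongs to the order ideal it generates. -/
lemma self_mem_idealSet {X : Type*} [Lattice X] [AddCommGroup X] [IsOrderedAddMonoid X]
    [Module ℝ X] {u : X} (hu : 0 ≤ u) : u ∈ idealSet u :=
  ⟨1, zero_le_one, by rw [one_smul, abs_of_nonneg hu]⟩

section IdealSet

variable {X : Type*} [Lattice X] [AddCommGroup X] [Module ℝ X] [PosSMulMono ℝ X]

/-- In an ordered vector lattice, `|c • a| ≤ |c| • |a|`. -/
lemma abs_smul_le_abs_smul_abs (c : ℝ) (a : X) : |c • a| ≤ |c| • |a| := by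
  have key : ∀ (d : ℝ) (b : X), 0 ≤ d → |d • b| ≤ d • |b| := by
    intro d b hd
    refine sup_le (smul_le_smul_of_nonneg_left (le_abs_self b) hd) ?_
    rw [← smul_neg]
    exact smul_le_smul_of_nonneg_left (neg_le_abs b) hd
  rcases le_total 0 c with hc | hc
  · rw [abs_of_nonneg hc]
    exact key c a hc
  · rw [abs_of_nonpos hc, ← abs_neg (c • a), ← neg_smul]
    exact key (-c) a (neg_nonneg.mpr hc)

variable [IsOrderedAddMonoid X]

/-- `I_u` is an order ideal. -/
lemma isOrderIdealSet_idealSet (u : X) : IsOrderIdealSet (idealSet u) := by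
  refine ⟨⟨0, le_rfl, by simp⟩, ?_, ?_, ?_⟩
  · rintro a ⟨c, hc, hac⟩ b ⟨d, hd, hbd⟩
    refine ⟨c + d, add_nonneg hc hd, (abs_add_le a b).trans ?_⟩
    rw [add_smul]
    exact add_le_add hac hbd
  · rintro r a ⟨c, hc, hac⟩
    refine ⟨|r| * c, mul_nonneg (abs_nonneg r) hc, (abs_smul_le_abs_smul_abs r a).trans ?_⟩
    rw [mul_smul]
    exact smul_le_smul_of_nonneg_left hac (abs_nonneg r)
  · rintro a ⟨c, hc, hac⟩ b hba
    exact ⟨c, hc, hba.trans hac⟩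

/-- An order ideal containing a nonnegative `u` contains `I_u`. -/
lemma idealSet_subset_of_mem {I : Set X} (hI : IsOrderIdealSet I) {u : X} (hu : 0 ≤ u)
    (huI : u ∈ I) : idealSet u ⊆ I := by
  rintro x ⟨c, hc, hx⟩
  refine hI.2.2.2 (c • u) (hI.2.2.1 c u huI) x ?_
  rwa [abs_of_nonneg (smul_nonneg hc hu)]

end IdealSet

section Mul

variable {X : Type*} [NonUnitalRing X]

/-- Powers of `e` multiply by adding exponents. -/
lemma powS_mul_powS (e : X) (m n : ℕ) : powS e m * powS e n = powS e (m + n + 1) := by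
  induction n with
  | zero => rfl
  | succ n ih =>
    change powS e m * (powS e n * e) = powS e (m + n + 1) * e
    rw [← mul_assoc, ih]

variable [Lattice X]

lemma powS_nonneg (hmulpos : ∀ a b : X, 0 ≤ a → 0 ≤ b → 0 ≤ a * b) {e : X} (he : 0 ≤ e)
    (m : ℕ) : 0 ≤ powS e m := by
  induction m with
  | zero => exact he
  | succ m ih => exact hmulpos _ _ ih he

variable [IsOrderedAddMonoid X]

/-- In a lattice-ordered ring, `|a * b| ≤ |a| * |b|`. -/
lemma abs_mul_le_abs_mul_abs (hmulpos : ∀ a b : X, 0 ≤ a → 0 ≤ b → 0 ≤ a * b) (a b : X) :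
    |a * b| ≤ |a| * |b| := by
  have hpp := hmulpos _ _ (posPart_nonneg a) (posPart_nonneg b)
  have hpn := hmulpos _ _ (posPart_nonneg a) (negPart_nonneg b)
  have hnp := hmulpos _ _ (negPart_nonneg a) (posPart_nonneg b)
  have hnn := hmulpos _ _ (negPart_nonneg a) (negPart_nonneg b)
  have hab : a * b = (a⁺ - a⁻) * (b⁺ - b⁻) := by
    rw [posPart_sub_negPart, posPart_sub_negPart]
  rw [← posPart_add_negPart a, ← posPart_add_negPart b, hab]
  refine sup_le (sub_nonneg.mp ?_) (sub_nonneg.mp ?_)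
  · have h := add_nonneg (add_nonneg hpn hnp) (add_nonneg hpn hnp)
    convert h using 1
    noncomm_ring
  · have h := add_nonneg (add_nonneg hpp hnn) (add_nonneg hpp hnn)
    convert h using 1
    noncomm_ring

variable [Module ℝ X] [PosSMulMono ℝ X] [IsScalarTower ℝ X X] [SMulCommClass ℝ X X]

/-- `I_u * I_v ⊆ I_{u * v}` for nonnegative `u`. -/
lemma mul_mem_idealSet_mul (hmulpos : ∀ a b : X, 0 ≤ a → 0 ≤ b → 0 ≤ a * b) {u v a b : X}
    (hu : 0 ≤ u) (ha : a ∈ idealSet u) (hb : b ∈ idealSet v) : a * b ∈ idealSet (u * v) := by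
  obtain ⟨c, hc, hac⟩ := ha
  obtain ⟨d, hd, hbd⟩ := hb
  refine ⟨c * d, mul_nonneg hc hd, (abs_mul_le_abs_mul_abs hmulpos a b).trans ?_⟩
  rw [← smul_mul_smul_comm]
  have h₁ := hmulpos _ _ (sub_nonneg.mpr hac) (abs_nonneg b)
  have h₂ := hmulpos _ _ (smul_nonneg hc hu) (sub_nonneg.mpr hbd)
  rw [sub_mul, sub_nonneg] at h₁
  rw [mul_sub, sub_nonneg] at h₂
  exact h₁.trans h₂

end Mul

/-- Lemma 3.5 / `lem:prelim3`: here `powS e m = e^(m+1)`, so the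
indexing `m ∈ ℕ = {1, 2, …}` of the paper corresponds to `powS e 0, powS e 1, …`. -/
theorem stmt_10 {X : Type*} [Lattice X] [NonUnitalRing X] [Module ℝ X]
    [CovariantClass X X (· + ·) (· ≤ ·)] [IsScalarTower ℝ X X] [SMulCommClass ℝ X X]
    (hsmulpos : ∀ (c : ℝ) (a : X), 0 ≤ c → 0 ≤ a → 0 ≤ c • a)
    (hmulpos : ∀ a b : X, 0 ≤ a → 0 ≤ b → 0 ≤ a * b)
    (harch : ∀ a b : X, 0 ≤ a → 0 ≤ b → (∀ k : ℕ, k • a ≤ b) → a = 0)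
    (e : X) (he : 0 ≤ e)
    (hpow : ∀ m : ℕ, powS e m ∈ idealSet (powS e (m + 1))) :
    (∀ m : ℕ, idealSet (powS e m) ⊆ idealSet (powS e (m + 1))) ∧
    ⋂₀ {I : Set X | IsOrderIdealSet I ∧ (∀ a ∈ I, ∀ b ∈ I, a * b ∈ I) ∧ e ∈ I}
      = ⋃ m : ℕ, idealSet (powS e m) := by
  have : IsOrderedAddMonoid X :=
    { add_le_add_left := fun a b h c => by
        rw [add_comm a c, add_comm b c]
        exact CovariantClass.elim (μ := ((· + ·) : X → X → X)) c h }
  have : PosSMulMono ℝ X := ⟨fun c hc a b h => by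
    rw [← sub_nonneg, ← smul_sub]
    exact hsmulpos c _ hc (sub_nonneg.mpr h)⟩
  have hpos := powS_nonneg hmulpos he
  have hstep : ∀ m, idealSet (powS e m) ⊆ idealSet (powS e (m + 1)) := fun m =>
    idealSet_subset_of_mem (isOrderIdealSet_idealSet _) (hpos m) (hpow m)
  have hmono : Monotone fun m => idealSet (powS e m) := monotone_nat_of_le_succ hstep
  refine ⟨hstep, Set.Subset.antisymm (Set.sInter_subset_of_mem ⟨⟨?_, ?_, ?_, ?_⟩, ?_, ?_⟩)
    (Set.subset_sInter ?_)⟩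
  · exact Set.mem_iUnion.mpr ⟨0, (isOrderIdealSet_idealSet _).1⟩
  · intro a ha b hb
    obtain ⟨m, ha⟩ := Set.mem_iUnion.mp ha
    obtain ⟨n, hb⟩ := Set.mem_iUnion.mp hb
    exact Set.mem_iUnion.mpr ⟨max m n, (isOrderIdealSet_idealSet _).2.1
      a (hmono (le_max_left m n) ha) b (hmono (le_max_right m n) hb)⟩
  · intro c a ha
    obtain ⟨m, ha⟩ := Set.mem_iUnion.mp ha
    exact Set.mem_iUnion.mpr ⟨m, (isOrderIdealSet_idealSet _).2.2.1 c a ha⟩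
  · intro a ha b hba
    obtain ⟨m, ha⟩ := Set.mem_iUnion.mp ha
    exact Set.mem_iUnion.mpr ⟨m, (isOrderIdealSet_idealSet _).2.2.2 a ha b hba⟩
  · intro a ha b hb
    obtain ⟨m, ha⟩ := Set.mem_iUnion.mp ha
    obtain ⟨n, hb⟩ := Set.mem_iUnion.mp hb
    refine Set.mem_iUnion.mpr ⟨m + n + 1, ?_⟩
    rw [← powS_mul_powS]
    exact mul_mem_idealSet_mul hmulpos (hpos m) ha hb
  · exact Set.mem_iUnion.mpr ⟨0, self_mem_idealSet he⟩
  · rintro I ⟨hI, hmul, heI⟩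
    have hpowI : ∀ m, powS e m ∈ I := by
      intro m
      induction m with
      | zero => exact heI
      | succ m ih => exact hmul _ ih _ heI
    exact Set.iUnion_subset fun m => idealSet_subset_of_mem hI (hpos m) (hpowI m)
end
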